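/- arXiv:2210.08629 — 3 statements merged into one kernel-verified Lean document; each statement's English description precedes it below -/
import Mathlib

section
/- Let k₁, k₂ > 1, 1 ≤ ℓ ≤ k₁−1, and 1 ≤ ℓ' ≤ k₂−1. If k₁ ≠ k₂ or ℓ ≠ ℓ', then the ℓ-Rauzy graph ℓ-R_f(k₁) of the infinite Fibonacci word is not isomorphic (as a directed graph) to the ℓ'-Rauzy graph ℓ'-R_f(k₂); that is, there is no bijection between their vertex sets under which (u,v) is an arc in one graph if and only if its image is an arc in the other. -/
noncomputable section

/-- τ = (√5 − 1)/2. -/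
def tau : ℝ := (Real.sqrt 5 - 1) / 2

/-- The infinite Fibonacci word: the n-th letter (n ≥ 1) is 1 if ⌊(n+1)τ⌋ = ⌊nτ⌋ and 0 otherwise. -/
def fibWord (n : ℕ) : ℕ :=
  if ⌊((n : ℝ) + 1) * tau⌋ = ⌊(n : ℝ) * tau⌋ then 1 else 0

/-- f[i;k] : the factor f_i f_{i+1} ⋯ f_{i+k-1}. -/
def fibFactor (i k : ℕ) : List ℕ :=
  (List.range k).map fun j => fibWord (i + j)

/-- L_f(k) : the set of factors of the infinite Fibonacci word of length k. -/
def fibFactors (k : ℕ) : Set (List ℕ) :=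
  { x | ∃ i, 1 ≤ i ∧ x = fibFactor i k }

/-- (u,v) is an arc of the ℓ-Rauzy graph ℓ-R_f(k): u,v are vertices,
the suffix of u of length ℓ equals the prefix of v of length ℓ, and
u₁⋯u_k v_{ℓ+1}⋯v_k ∈ L_f(2k−ℓ). -/
def lArc (k l : ℕ) (u v : List ℕ) : Prop :=
  u ∈ fibFactors k ∧ v ∈ fibFactors k ∧
    u.drop (k - l) = v.take l ∧ (u ++ v.drop l) ∈ fibFactors (2 * k - l)

theorem irrational_tau : Irrational tau := by
  have h : Irrational (Real.sqrt 5) := by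
    simpa using Nat.Prime.irrational_sqrt (p := 5) (by norm_num)
  have h' := (h.sub_natCast 1).div_natCast (m := 2) (by norm_num)
  simpa [tau] using h'

theorem tau_pos : 0 < tau := by
  have : (1 : ℝ) < Real.sqrt 5 := Real.lt_sqrt_of_sq_lt (by norm_num)
  unfold tau
  linarith

theorem tau_lt_one : tau < 1 := by
  have : Real.sqrt 5 < 3 := by
    rw [Real.sqrt_lt' (by norm_num)]
    norm_num
  unfold tau
  linarith

theorem fibWord_lt_two (n : ℕ) : fibWord n < 2 := by
  unfold fibWord
  split_ifs <;> norm_num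

/-- The letters of the Fibonacci word are the complements of the increments of `⌊n τ⌋`. -/
theorem floor_succ_mul_tau (n : ℕ) :
    ⌊((n + 1 : ℕ) : ℝ) * tau⌋ = ⌊(n : ℝ) * tau⌋ + 1 - (fibWord n : ℤ) := by
  have h0 := tau_pos
  have h1 := tau_lt_one
  have hle : ⌊(n : ℝ) * tau⌋ ≤ ⌊((n : ℝ) + 1) * tau⌋ := Int.floor_le_floor (by nlinarith)
  have hlt : ⌊((n : ℝ) + 1) * tau⌋ ≤ ⌊(n : ℝ) * tau⌋ + 1 := by
    rw [← Int.floor_add_one]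
    exact Int.floor_le_floor (by nlinarith)
  push_cast
  unfold fibWord
  split_ifs with h
  · rw [h]
    simp
  · push_cast
    omega

/-- The Fibonacci word is not eventually periodic. -/
theorem fibWord_not_eventually_periodic (i p : ℕ) (hp : 0 < p)
    (h : ∀ m, fibWord (i + p + m) = fibWord (i + m)) : False := by
  set F : ℕ → ℤ := fun n => ⌊(n : ℝ) * tau⌋ with hF
  have hstep : ∀ n, F (n + 1) = F n + 1 - (fibWord n : ℤ) := floor_succ_mul_tau
  set c : ℤ := F (i + p) - F i with hc
  have hshift : ∀ m, F (i + p + m) = F (i + m) + c := by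
    intro m
    induction m with
    | zero => simp [hc]
    | succ m ih =>
      rw [← add_assoc, ← add_assoc, hstep, hstep, ih, h m]
      ring
  have hmul : ∀ t : ℕ, F (i + t * p) = F i + t * c := by
    intro t
    induction t with
    | zero => simp
    | succ t ih =>
      rw [show i + (t + 1) * p = i + p + t * p by ring, hshift, ih]
      push_cast
      ring
  have hbound : ∀ t : ℕ, |(t : ℝ) * (p * tau - c)| ≤ 1 := by
    intro t
    have e := congrArg (fun z : ℤ => (z : ℝ)) (hmul t)
    have a1 := Int.floor_le (((i + t * p : ℕ) : ℝ) * tau)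
    have a2 := Int.lt_floor_add_one (((i + t * p : ℕ) : ℝ) * tau)
    have b1 := Int.floor_le ((i : ℝ) * tau)
    have b2 := Int.lt_floor_add_one ((i : ℝ) * tau)
    simp only [hF] at e
    rw [Int.cast_add, Int.cast_mul, Int.cast_natCast] at e
    rw [e] at a1 a2
    push_cast at a1 a2
    rw [abs_le]
    constructor <;> nlinarith
  have hzero : (p : ℝ) * tau - c = 0 := by
    by_contra hne
    obtain ⟨t, ht⟩ := exists_nat_gt (1 / |(p : ℝ) * tau - c|)
    have hpos := abs_pos.mpr hne
    rw [div_lt_iff₀ hpos] at ht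
    have := hbound t
    rw [abs_mul, Nat.abs_cast] at this
    linarith
  refine (irrational_tau.natCast_mul hp.ne').ne_int c ?_
  linarith

theorem fibFactor_length (i k : ℕ) : (fibFactor i k).length = k := by
  simp [fibFactor]

theorem fibFactor_eq_iff (i j k : ℕ) :
    fibFactor i k = fibFactor j k ↔ ∀ m < k, fibWord (i + m) = fibWord (j + m) := by
  simp [fibFactor, List.map_inj_left]

theorem fibFactor_append (i a b : ℕ) :
    fibFactor i a ++ fibFactor (i + a) b = fibFactor i (a + b) := by
  simp [fibFactor, List.range_add, add_assoc, Function.comp_def]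

theorem take_fibFactor (i a b : ℕ) : (fibFactor i (a + b)).take a = fibFactor i a := by
  rw [← fibFactor_append, List.take_left' (fibFactor_length i a)]

theorem drop_fibFactor (i a b : ℕ) : (fibFactor i (a + b)).drop a = fibFactor (i + a) b := by
  rw [← fibFactor_append, List.drop_left' (fibFactor_length i a)]

theorem fibFactors_length {k : ℕ} {u : List ℕ} (hu : u ∈ fibFactors k) : u.length = k := by
  obtain ⟨i, -, rfl⟩ := hu
  exact fibFactor_length i k

theorem fibFactors_finite (k : ℕ) : (fibFactors k).Finite := by
  refine (Set.finite_range fun g : Fin k → Fin 2 => List.ofFn fun j => (g j : ℕ)).subset ?_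
  rintro _ ⟨i, -, rfl⟩
  refine ⟨fun j => ⟨fibWord (i + j), fibWord_lt_two _⟩, ?_⟩
  apply List.ext_getElem <;> simp [fibFactor]

/-- There is a right special factor of every length. -/
theorem exists_right_special (n : ℕ) : ∃ i j, 1 ≤ i ∧ 1 ≤ j ∧
    fibFactor i n = fibFactor j n ∧ fibFactor i (n + 1) ≠ fibFactor j (n + 1) := by
  by_contra! hcon
  have hext : ∀ i j, 1 ≤ i → 1 ≤ j → fibFactor i n = fibFactor j n →
      ∀ m, fibFactor i (n + m) = fibFactor j (n + m) := by
    intro i j hi hj h m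
    induction m generalizing i j with
    | zero => exact h
    | succ m ih =>
      have h1 := hcon i j hi hj h
      rw [add_comm n 1] at h1
      have hd := congrArg (List.drop 1) h1
      rw [drop_fibFactor, drop_fibFactor] at hd
      have h2 := ih (i + 1) (j + 1) (by omega) (by omega) hd
      have ht := congrArg (List.take 1) h1
      rw [take_fibFactor, take_fibFactor] at ht
      rw [show n + (m + 1) = 1 + (n + m) by ring, ← fibFactor_append i, ← fibFactor_append j,
        ht, h2]
  have hper : ∀ i j, 1 ≤ i → i < j → fibFactor i n = fibFactor j n → False := by
    intro i j hi hij h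
    refine fibWord_not_eventually_periodic i (j - i) (by omega) fun m => ?_
    rw [Nat.add_sub_cancel' hij.le]
    exact ((fibFactor_eq_iff i j _).1 (hext i j hi (by omega) h (m + 1)) m (by omega)).symm
  obtain ⟨a, -, b, -, hab, h⟩ := Set.infinite_univ.exists_ne_map_eq_of_mapsTo
    (f := fun i : ℕ => fibFactor (i + 1) n) (t := fibFactors n)
    (fun i _ => ⟨i + 1, by omega, rfl⟩) (fibFactors_finite n)
  rcases lt_or_gt_of_ne hab with hlt | hlt
  · exact hper (a + 1) (b + 1) (by omega) (by omega) h
  · exact hper (b + 1) (a + 1) (by omega) (by omega) h.symm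

/-- The factor complexity of the Fibonacci word is strictly increasing. -/
theorem ncard_fibFactors_strictMono : StrictMono fun n => (fibFactors n).ncard := by
  refine strictMono_nat_of_lt_succ fun n => ?_
  have himage : List.take n '' fibFactors (n + 1) = fibFactors n := by
    ext u
    constructor
    · rintro ⟨_, ⟨i, hi, rfl⟩, rfl⟩
      exact ⟨i, hi, take_fibFactor i n 1⟩
    · rintro ⟨i, hi, rfl⟩
      exact ⟨_, ⟨i, hi, rfl⟩, take_fibFactor i n 1⟩
  have hle := Set.ncard_image_le (f := List.take n) (fibFactors_finite (n + 1))
  rw [himage] at hle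
  refine lt_of_le_of_ne hle fun heq => ?_
  have hinj : Set.InjOn (List.take n) (fibFactors (n + 1)) :=
    Set.injOn_of_ncard_image_eq (by rw [himage, heq]) (fibFactors_finite (n + 1))
  obtain ⟨i, j, hi, hj, h, hne⟩ := exists_right_special n
  exact hne (hinj ⟨i, hi, rfl⟩ ⟨j, hj, rfl⟩ (by simpa only [take_fibFactor] using h))

/-- The arcs of the `l`-Rauzy graph of order `k` correspond to the factors of length `2k - l`. -/
theorem bijOn_arcs_fibFactors {k l : ℕ} (hl : l ≤ k) :
    Set.BijOn (fun p : List ℕ × List ℕ => p.1 ++ p.2.drop l)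
      {p | lArc k l p.1 p.2} (fibFactors (2 * k - l)) := by
  refine ⟨fun p hp => hp.2.2.2, ?_, ?_⟩
  · rintro ⟨u, v⟩ ⟨hu, -, huv, -⟩ ⟨u', v'⟩ ⟨hu', -, huv', -⟩ h
    obtain ⟨h1, h2⟩ := List.append_inj h
      ((fibFactors_length hu).trans (fibFactors_length hu').symm)
    dsimp only at h1 h2 huv huv'
    subst h1
    rw [← List.take_append_drop l v, ← List.take_append_drop l v', ← huv, ← huv', h2]
  · rintro _ ⟨i, hi, rfl⟩
    obtain ⟨d, rfl⟩ := Nat.exists_eq_add_of_le' hl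
    have happ : fibFactor i (d + l) ++ (fibFactor (i + d) (l + d)).drop l =
        fibFactor i (2 * (d + l) - l) := by
      rw [drop_fibFactor, add_assoc i d l, fibFactor_append]
      congr 1
      omega
    rw [add_comm l d] at happ
    refine ⟨(fibFactor i (d + l), fibFactor (i + d) (d + l)),
      ⟨⟨i, hi, rfl⟩, ⟨i + d, by omega, rfl⟩, ?_, ⟨i, hi, happ⟩⟩, happ⟩
    dsimp only
    rw [Nat.add_sub_cancel, drop_fibFactor, add_comm d l, take_fibFactor]

/-- If k₁ ≠ k₂ or ℓ ≠ ℓ' then ℓ-R_f(k₁) and ℓ'-R_f(k₂) are not isomorphic as directed graphs. -/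
theorem fib_lRauzy_not_iso (k₁ k₂ l l' : ℕ) (hk₁ : 1 < k₁) (hk₂ : 1 < k₂)
    (hl1 : 1 ≤ l) (hl2 : l ≤ k₁ - 1) (hl1' : 1 ≤ l') (hl2' : l' ≤ k₂ - 1)
    (hne : k₁ ≠ k₂ ∨ l ≠ l') :
    ¬ ∃ φ : List ℕ → List ℕ,
        Set.BijOn φ (fibFactors k₁) (fibFactors k₂) ∧
        ∀ u ∈ fibFactors k₁, ∀ v ∈ fibFactors k₁,
          (lArc k₁ l u v ↔ lArc k₂ l' (φ u) (φ v)) := by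
  rintro ⟨φ, hφ, harc⟩
  have hk : k₁ = k₂ := ncard_fibFactors_strictMono.injective (Set.BijOn.ncard_eq hφ)
  have harcs : Set.BijOn (Prod.map φ φ) {p | lArc k₁ l p.1 p.2} {p | lArc k₂ l' p.1 p.2} := by
    refine ⟨fun p hp => (harc _ hp.1 _ hp.2.1).1 hp, fun p hp q hq h => ?_, ?_⟩
    · rw [Prod.ext_iff] at h
      exact Prod.ext (hφ.injOn hp.1 hq.1 h.1) (hφ.injOn hp.2.1 hq.2.1 h.2)
    · rintro ⟨a, b⟩ hab
      obtain ⟨u, hu, rfl⟩ := hφ.surjOn hab.1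
      obtain ⟨v, hv, rfl⟩ := hφ.surjOn hab.2.1
      exact ⟨(u, v), (harc u hu v hv).2 hab, rfl⟩
  have hcard : (fibFactors (2 * k₁ - l)).ncard = (fibFactors (2 * k₂ - l')).ncard := by
    rw [← (bijOn_arcs_fibFactors (k := k₁) (l := l) (by omega)).ncard_eq,
      ← (bijOn_arcs_fibFactors (k := k₂) (l := l') (by omega)).ncard_eq, harcs.ncard_eq]
  have hlen : 2 * k₁ - l = 2 * k₂ - l' := ncard_fibFactors_strictMono.injective hcard
  omega
end
end

section
/- For every k > 1, every 1 ≤ p ≤ k−1, and every factor v of the infinite Fibonacci word f of length k, there exist infinitely many integers m ≥ 0 such that f[1 + m·p; k] = v; in particular every factor of f of length k occurs at some position of the form 1 + m·p. -/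
noncomputable section

/-- Natural multiples of an irrational number are dense modulo one, and each interval is visited
infinitely often. -/
theorem Irrational.frequently_exists_int_abs_sub_lt {a : ℝ} (ha : Irrational a) (y : ℝ) {ε : ℝ}
    (hε : 0 < ε) : ∃ᶠ m : ℕ in Filter.atTop, ∃ N : ℤ, |m * a - y - N| < ε := by
  have hdense : DenseRange (fun n : ℤ => n • (a : UnitAddCircle)) :=
    AddCircle.denseRange_zsmul_coe_iff.2 (by simpa using ha)
  have hcluster : MapClusterPt (y : UnitAddCircle) Filter.atTop
      (fun n : ℕ => n • (a : UnitAddCircle)) :=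
    ((mapClusterPt_atTop_nsmul_tfae (y : UnitAddCircle) (a : UnitAddCircle)).out 0 3).2 (hdense _)
  refine (hcluster.frequently (Metric.ball_mem_nhds _ hε)).mono fun m hm => ?_
  refine ⟨round (m * a - y), ?_⟩
  rw [dist_eq_norm, ← AddCircle.coe_nsmul, ← AddCircle.coe_sub, UnitAddCircle.norm_eq,
    nsmul_eq_mul] at hm
  exact hm

/-- Finitely many floors are unchanged by a sufficiently small shift to the right. -/
theorem exists_pos_forall_floor_add_eq (x : ℕ → ℝ) (n : ℕ) :
    ∃ ε > 0, ∀ δ, 0 ≤ δ → δ < ε → ∀ j < n, ⌊x j + δ⌋ = ⌊x j⌋ := by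
  induction n with
  | zero => exact ⟨1, one_pos, by simp⟩
  | succ n ih =>
    obtain ⟨ε, hε, h⟩ := ih
    refine ⟨min ε (1 - Int.fract (x n)), lt_min hε (sub_pos.2 (Int.fract_lt_one _)), ?_⟩
    intro δ h0 hδ j hj
    rcases Nat.lt_succ_iff_lt_or_eq.1 hj with hj | rfl
    · exact h δ h0 (hδ.trans_le (min_le_left _ _)) j hj
    · have hlt := hδ.trans_le (min_le_right _ _)
      rw [Int.fract] at hlt
      exact Int.floor_eq_iff.2 ⟨by linarith [Int.floor_le (x j)], by linarith⟩

/-- Two factors of equal length agree if the rotation angles of their starting positions are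
close enough, from the right, modulo one. -/
theorem exists_pos_forall_fibFactor_eq (i k : ℕ) :
    ∃ ε > 0, ∀ (n : ℕ) (N : ℤ), 0 ≤ n * tau - i * tau - N → n * tau - i * tau - N < ε →
      fibFactor n k = fibFactor i k := by
  obtain ⟨ε, hε, h⟩ := exists_pos_forall_floor_add_eq (fun j => ((i : ℝ) + j) * tau) (k + 1)
  refine ⟨ε, hε, fun n N h0 hlt => ?_⟩
  have hfloor : ∀ j < k + 1, ⌊((n : ℝ) + j) * tau⌋ = ⌊((i : ℝ) + j) * tau⌋ + N := by
    intro j hj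
    rw [← h _ h0 hlt j hj, ← Int.floor_add_intCast]
    congr 1
    ring
  refine List.map_congr_left fun j hj => ?_
  have hj := List.mem_range.1 hj
  have h1 := hfloor j (by omega)
  have h2 := hfloor (j + 1) (by omega)
  push_cast at h2
  simp only [fibWord, Nat.cast_add, add_assoc, h1, h2, add_left_inj]

/-- Every factor of f of length k occurs at infinitely many positions of the form 1 + m·p,
for any 1 ≤ p ≤ k−1. -/
theorem fib_occurs_in_progression (k p : ℕ) (hk : 1 < k) (hp1 : 1 ≤ p) (hp2 : p ≤ k - 1) :
    ∀ v ∈ fibFactors k, {m : ℕ | fibFactor (1 + m * p) k = v}.Infinite := by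
  rintro v ⟨i, -, rfl⟩
  obtain ⟨ε, hε, h⟩ := exists_pos_forall_fibFactor_eq i k
  rw [← Nat.frequently_atTop_iff_infinite]
  refine ((irrational_tau.natCast_mul (Nat.one_le_iff_ne_zero.1 hp1)).frequently_exists_int_abs_sub_lt
    (i * tau - tau + ε / 2) (half_pos hε)).mono ?_
  rintro m ⟨N, hN⟩
  obtain ⟨hlow, hup⟩ := abs_lt.1 hN
  refine h _ N ?_ ?_ <;> push_cast <;> linarith
end
end

section
/- The 2-Rauzy graph of order 4 for the Thue–Morse word T is not weakly connected: its vertex set L_T(4) consists of the 10 words 0110, 1101, 1010, 0100, 1001, 0011, 1100, 0010, 0101, 1011, and there exist two vertices that are not joined by any path in the underlying undirected graph of 2-R_T(4). -/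
/-- The Thue–Morse word: the n-th letter (n ≥ 0) is the parity of the number of 1s
in the binary expansion of n. -/
def thueMorse (n : ℕ) : ℕ := (Nat.digits 2 n).sum % 2

/-- L_T(k) : the set of factors of the Thue–Morse word of length k. -/
def tmFactors (k : ℕ) : Set (List ℕ) :=
  { x | ∃ i : ℕ, x = (List.range k).map fun j => thueMorse (i + j) }

/-- The arc relation of the ℓ-Rauzy graph ℓ-R_T(k) of the Thue–Morse word. -/
def tmArc (k l : ℕ) (u v : List ℕ) : Prop :=
  u ∈ tmFactors k ∧ v ∈ tmFactors k ∧
    u.drop (k - l) = v.take l ∧ (u ++ v.drop l) ∈ tmFactors (2 * k - l)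

theorem thueMorse_two_mul (n : ℕ) : thueMorse (2 * n) = thueMorse n := by
  rcases Nat.eq_zero_or_pos n with rfl | hn
  · rfl
  · have h := Nat.digits_add_two_add_one 0 (2 * n - 1)
    have e : 2 * n - 1 + 1 = 2 * n := by omega
    simp only [Nat.zero_add, e] at h
    simp [thueMorse, h]

theorem thueMorse_two_mul_add_one (n : ℕ) :
    thueMorse (2 * n + 1) = 1 - thueMorse n := by
  have h := Nat.digits_add_two_add_one 0 (2 * n)
  have e : (2 * n + 1) / 2 = n := by omega
  have e' : (2 * n + 1) % 2 = 1 := by omega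
  simp only [Nat.zero_add, e, e'] at h
  simp only [thueMorse, h, List.sum_cons]
  omega

theorem thueMorse_lt_two (n : ℕ) : thueMorse n < 2 := Nat.mod_lt _ two_pos

theorem thueMorse_two_mul_ne (n : ℕ) : thueMorse (2 * n) ≠ thueMorse (2 * n + 1) := by
  rw [thueMorse_two_mul, thueMorse_two_mul_add_one]
  omega

/-- The Thue–Morse word contains neither `000` nor `111`. -/
theorem thueMorse_not_three_eq (n : ℕ) :
    ¬ (thueMorse n = thueMorse (n + 1) ∧ thueMorse (n + 1) = thueMorse (n + 2)) := by
  rintro ⟨h₁, h₂⟩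
  obtain ⟨m, rfl | rfl⟩ := n.even_or_odd'
  · exact thueMorse_two_mul_ne m h₁
  · exact thueMorse_two_mul_ne (m + 1) h₂

/-- The factor of length four at position `i` is a product of two blocks from `{01, 10}`
exactly when `i` is even. -/
theorem thueMorse_blocks_iff_even (i : ℕ) :
    (thueMorse i ≠ thueMorse (i + 1) ∧ thueMorse (i + 2) ≠ thueMorse (i + 3)) ↔ Even i := by
  obtain ⟨n, rfl | rfl⟩ := i.even_or_odd'
  · exact iff_of_true ⟨thueMorse_two_mul_ne n, thueMorse_two_mul_ne (n + 1)⟩ (even_two_mul n)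
  · refine iff_of_false ?_ (by simp)
    have h₀ := thueMorse_two_mul_add_one n
    have h₁ : thueMorse (2 * n + 1 + 1) = _ := thueMorse_two_mul (n + 1)
    have h₂ : thueMorse (2 * n + 1 + 2) = _ := thueMorse_two_mul_add_one (n + 1)
    have h₃ : thueMorse (2 * n + 1 + 3) = _ := thueMorse_two_mul (n + 2)
    have := thueMorse_lt_two n
    have := thueMorse_lt_two (n + 1)
    have := thueMorse_lt_two (n + 2)
    have := thueMorse_not_three_eq n
    omega

theorem mem_tmFactors_four {x : List ℕ} : x ∈ tmFactors 4 ↔ ∃ i, x =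
    [thueMorse i, thueMorse (i + 1), thueMorse (i + 2), thueMorse (i + 3)] := Iff.rfl

theorem mem_tmFactors_six {x : List ℕ} : x ∈ tmFactors 6 ↔ ∃ i, x =
    [thueMorse i, thueMorse (i + 1), thueMorse (i + 2), thueMorse (i + 3),
      thueMorse (i + 4), thueMorse (i + 5)] := Iff.rfl

theorem tmFactors_four : tmFactors 4 =
    {[0,1,1,0], [1,1,0,1], [1,0,1,0], [0,1,0,0], [1,0,0,1],
      [0,0,1,1], [1,1,0,0], [0,0,1,0], [0,1,0,1], [1,0,1,1]} := by
  ext x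
  constructor
  · rw [mem_tmFactors_four]
    rintro ⟨i, rfl⟩
    have a₀ := thueMorse_lt_two i
    have a₁ := thueMorse_lt_two (i + 1)
    have a₂ := thueMorse_lt_two (i + 2)
    have a₃ := thueMorse_lt_two (i + 3)
    have c₀ := thueMorse_not_three_eq i
    have c₁ : ¬ (thueMorse (i + 1) = thueMorse (i + 2) ∧ thueMorse (i + 2) = thueMorse (i + 3)) :=
      thueMorse_not_three_eq (i + 1)
    generalize thueMorse i = a, thueMorse (i + 1) = b, thueMorse (i + 2) = c,
      thueMorse (i + 3) = d at *
    interval_cases a <;> interval_cases b <;> interval_cases c <;> interval_cases d <;> simp_all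
  · rintro (rfl | rfl | rfl | rfl | rfl | rfl | rfl | rfl | rfl | rfl)
    exacts [⟨0, rfl⟩, ⟨1, rfl⟩, ⟨2, rfl⟩,
      ⟨3, rfl⟩, ⟨4, rfl⟩, ⟨5, rfl⟩,
      ⟨7, rfl⟩, ⟨9, rfl⟩, ⟨10, rfl⟩,
      ⟨11, rfl⟩]

/-- The first four letters of the word form two blocks from `{01, 10}`. -/
def StartsWithTwoBlocks (x : List ℕ) : Prop :=
  x[0]? ≠ x[1]? ∧ x[2]? ≠ x[3]?

theorem tmArc.startsWithTwoBlocks_iff {u v : List ℕ} (h : tmArc 4 2 u v) :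
    StartsWithTwoBlocks u ↔ StartsWithTwoBlocks v := by
  obtain ⟨hu, hv, huv, hw⟩ := h
  obtain ⟨p, rfl⟩ := mem_tmFactors_four.1 hu
  obtain ⟨q, rfl⟩ := mem_tmFactors_four.1 hv
  obtain ⟨i, hi⟩ := mem_tmFactors_six.1 hw
  simp only [List.drop_succ_cons, List.drop_zero, List.take_succ_cons, List.take_zero,
    List.cons_append, List.nil_append, List.cons.injEq, and_true, Nat.reduceSub] at huv hi
  obtain ⟨h₀, h₁, h₂, h₃, h₄, h₅⟩ := hi
  have e₀ := thueMorse_blocks_iff_even i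
  have e₁ : (thueMorse (i + 2) ≠ thueMorse (i + 3) ∧
    thueMorse (i + 4) ≠ thueMorse (i + 5)) ↔ Even (i + 2) := thueMorse_blocks_iff_even (i + 2)
  have e₂ : Even (i + 2) ↔ Even i := by simp [Nat.even_add]
  simp only [StartsWithTwoBlocks, List.getElem?_cons_zero, List.getElem?_cons_succ, ne_eq,
    Option.some.injEq, ← huv.1, ← huv.2, h₀, h₁, h₂, h₃, h₄, h₅]
  exact e₀.trans (e₂.symm.trans e₁.symm)

/-- The 2-Rauzy graph of order 4 of the Thue–Morse word has the stated 10 vertices and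
is not weakly connected: some two vertices are joined by no path in the underlying
undirected graph. -/
theorem thueMorse_2Rauzy_not_connected :
    tmFactors 4 = {[0,1,1,0], [1,1,0,1], [1,0,1,0], [0,1,0,0], [1,0,0,1],
      [0,0,1,1], [1,1,0,0], [0,0,1,0], [0,1,0,1], [1,0,1,1]} ∧
    ∃ u ∈ tmFactors 4, ∃ v ∈ tmFactors 4,
      ¬ Relation.ReflTransGen (fun a b => tmArc 4 2 a b ∨ tmArc 4 2 b a) u v := by
  refine ⟨tmFactors_four, [0,1,1,0], by simp [tmFactors_four], [1,1,0,1],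
    by simp [tmFactors_four], fun h => ?_⟩
  have key : ∀ v, Relation.ReflTransGen (fun a b => tmArc 4 2 a b ∨ tmArc 4 2 b a) [0,1,1,0] v →
      StartsWithTwoBlocks v := by
    intro v hv
    induction hv with
    | refl => simp [StartsWithTwoBlocks]
    | tail _ hbc ih =>
      exact hbc.elim (fun h => h.startsWithTwoBlocks_iff.1 ih)
        fun h => h.startsWithTwoBlocks_iff.2 ih
  simpa [StartsWithTwoBlocks] using key _ h
end
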